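/- arXiv:2305.02656 — 4 statements merged into one kernel-verified Lean document; each statement's English description precedes it below -/
import Mathlib

section
/- Let a, b ≥ 1. Let T be an abelian subgroup of the group of invertible 2^a × 2^a complex matrices all of whose elements are signed a-qubit Pauli strings, and let S be an abelian subgroup of the group of invertible 2^{a+b} × 2^{a+b} complex matrices all of whose elements are signed (a+b)-qubit Pauli strings. Then the set U = { u | u is a signed b-qubit Pauli string and there exists t ∈ T with t ⊗ u ∈ S } is an abelian subgroup of the group of invertible 2^b × 2^b complex matrices (under matrix multiplication). -/
/-- The four single-qubit Pauli matrices: `I`, `X`, `Y`, `Z`. -/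
noncomputable def pauliMat : Fin 4 → Matrix (Fin 2) (Fin 2) ℂ :=
  ![1, !![0, 1; 1, 0], !![0, -Complex.I; Complex.I, 0], !![1, 0; 0, -1]]

/-- The `n`-qubit Pauli string `P_σ`, the Kronecker product of the matrices `pauliMat (σ i)`. -/
noncomputable def pauliString {n : ℕ} (σ : Fin n → Fin 4) :
    Matrix (Fin n → Fin 2) (Fin n → Fin 2) ℂ :=
  Matrix.of fun x y => ∏ i, pauliMat (σ i) (x i) (y i)

/-- A signed `n`-qubit Pauli string: `ε • P_σ` with `ε ∈ {1, -1}`. -/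
def IsSignedPauli {n : ℕ} (M : Matrix (Fin n → Fin 2) (Fin n → Fin 2) ℂ) : Prop :=
  ∃ (ε : ℂ) (σ : Fin n → Fin 4), (ε = 1 ∨ ε = -1) ∧ M = ε • pauliString σ

/-- The identification of `(a+b)`-qubit basis labels with pairs of `a`-qubit and `b`-qubit
basis labels. -/
def splitEquiv (a b : ℕ) : (Fin (a + b) → Fin 2) ≃ (Fin a → Fin 2) × (Fin b → Fin 2) :=
  (Equiv.arrowCongr finSumFinEquiv.symm (Equiv.refl (Fin 2))).trans
    (Equiv.sumArrowEquivProdArrow (Fin a) (Fin b) (Fin 2))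

/-- The Kronecker product of an `a`-qubit matrix with a `b`-qubit matrix, viewed as an
`(a+b)`-qubit matrix via `splitEquiv`. -/
noncomputable def kronAB {a b : ℕ} (t : Matrix (Fin a → Fin 2) (Fin a → Fin 2) ℂ)
    (u : Matrix (Fin b → Fin 2) (Fin b → Fin 2) ℂ) :
    Matrix (Fin (a + b) → Fin 2) (Fin (a + b) → Fin 2) ℂ :=
  Matrix.of fun x y =>
    t (splitEquiv a b x).1 (splitEquiv a b y).1 * u (splitEquiv a b x).2 (splitEquiv a b y).2

theorem pauliMat_mul_self (p : Fin 4) : pauliMat p * pauliMat p = 1 := by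
  fin_cases p <;> ext i j <;> fin_cases i <;> fin_cases j <;> simp [pauliMat]

/-- The product of two Pauli matrices is a Pauli matrix up to a scalar. -/
theorem exists_pauliMat_mul_eq_smul (p q : Fin 4) :
    ∃ (c : ℂ) (r : Fin 4), pauliMat p * pauliMat q = c • pauliMat r := by
  have hXY : pauliMat 1 * pauliMat 2 = Complex.I • pauliMat 3 := by
    ext i j; fin_cases i <;> fin_cases j <;> simp [pauliMat]
  have hYX : pauliMat 2 * pauliMat 1 = (-Complex.I) • pauliMat 3 := by
    ext i j; fin_cases i <;> fin_cases j <;> simp [pauliMat]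
  have hYZ : pauliMat 2 * pauliMat 3 = Complex.I • pauliMat 1 := by
    ext i j; fin_cases i <;> fin_cases j <;> simp [pauliMat]
  have hZY : pauliMat 3 * pauliMat 2 = (-Complex.I) • pauliMat 1 := by
    ext i j; fin_cases i <;> fin_cases j <;> simp [pauliMat]
  have hZX : pauliMat 3 * pauliMat 1 = Complex.I • pauliMat 2 := by
    ext i j; fin_cases i <;> fin_cases j <;> simp [pauliMat]
  have hXZ : pauliMat 1 * pauliMat 3 = (-Complex.I) • pauliMat 2 := by
    ext i j; fin_cases i <;> fin_cases j <;> simp [pauliMat]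
  have h0 : pauliMat 0 = 1 := rfl
  rcases eq_or_ne p q with rfl | hpq
  · exact ⟨1, 0, by rw [pauliMat_mul_self, h0, one_smul]⟩
  rcases eq_or_ne p 0 with rfl | hp
  · exact ⟨1, q, by rw [h0, one_mul, one_smul]⟩
  rcases eq_or_ne q 0 with rfl | hq
  · exact ⟨1, p, by rw [h0, mul_one, one_smul]⟩
  fin_cases p <;> fin_cases q <;> first
    | exact absurd rfl hp
    | exact absurd rfl hq
    | exact absurd rfl hpq
    | exact ⟨_, _, hXY⟩
    | exact ⟨_, _, hYZ⟩
    | exact ⟨_, _, hZX⟩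
    | exact ⟨_, _, hYX⟩
    | exact ⟨_, _, hZY⟩
    | exact ⟨_, _, hXZ⟩

theorem pauliString_mul_apply {n : ℕ} (σ τ : Fin n → Fin 4) (x y : Fin n → Fin 2) :
    (pauliString σ * pauliString τ) x y =
      ∏ i, (pauliMat (σ i) * pauliMat (τ i)) (x i) (y i) := by
  simp only [Matrix.mul_apply, pauliString, Matrix.of_apply, ← Finset.prod_mul_distrib,
    Finset.prod_univ_sum, Fintype.piFinset_univ]

theorem Matrix.prod_one_apply {ι κ R : Type*} [Fintype ι] [DecidableEq κ] [DecidableEq (ι → κ)]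
    [CommSemiring R] (x y : ι → κ) :
    ∏ i, (1 : Matrix κ κ R) (x i) (y i) = (1 : Matrix (ι → κ) (ι → κ) R) x y := by
  simp only [Matrix.one_apply, Finset.prod_ite_zero, Finset.mem_univ, true_imp_iff,
    Finset.prod_const_one, funext_iff]

theorem pauliString_zero {n : ℕ} : pauliString (0 : Fin n → Fin 4) = 1 := by
  ext x y
  exact Matrix.prod_one_apply x y

theorem pauliString_mul_self {n : ℕ} (σ : Fin n → Fin 4) : pauliString σ * pauliString σ = 1 := by
  ext x y
  simp only [pauliString_mul_apply, pauliMat_mul_self, Matrix.prod_one_apply]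

theorem exists_pauliString_mul_eq_smul {n : ℕ} (σ τ : Fin n → Fin 4) :
    ∃ (c : ℂ) (ρ : Fin n → Fin 4), pauliString σ * pauliString τ = c • pauliString ρ := by
  choose c r h using fun i => exists_pauliMat_mul_eq_smul (σ i) (τ i)
  refine ⟨∏ i, c i, r, ?_⟩
  ext x y
  simp only [pauliString_mul_apply, h, Matrix.smul_apply, smul_eq_mul, Finset.prod_mul_distrib]
  rfl

namespace IsSignedPauli

variable {n : ℕ} {M N : Matrix (Fin n → Fin 2) (Fin n → Fin 2) ℂ}

theorem one : IsSignedPauli (1 : Matrix (Fin n → Fin 2) (Fin n → Fin 2) ℂ) :=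
  ⟨1, 0, Or.inl rfl, by rw [pauliString_zero, one_smul]⟩

theorem mul_self (hM : IsSignedPauli M) : M * M = 1 := by
  obtain ⟨ε, σ, hε, rfl⟩ := hM
  rw [smul_mul_smul_comm, pauliString_mul_self, mul_self_eq_one_iff.2 hε, one_smul]

/-- Commuting signed Pauli strings multiply to an involution, which forces the phase of the
product to be a sign. -/
theorem mul_of_commute (hM : IsSignedPauli M) (hN : IsSignedPauli N) (hMN : Commute M N) :
    IsSignedPauli (M * N) := by
  have hsq : M * N * (M * N) = 1 := by
    rw [hMN.symm.mul_mul_mul_comm, hM.mul_self, hN.mul_self, one_mul]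
  obtain ⟨ε, σ, -, rfl⟩ := hM
  obtain ⟨δ, τ, -, rfl⟩ := hN
  obtain ⟨c, ρ, h⟩ := exists_pauliString_mul_eq_smul σ τ
  have hprod : ε • pauliString σ * δ • pauliString τ = (ε * δ * c) • pauliString ρ := by
    rw [smul_mul_smul_comm, h, smul_smul]
  refine ⟨ε * δ * c, ρ, ?_, hprod⟩
  rw [hprod, smul_mul_smul_comm, pauliString_mul_self] at hsq
  have hentry := congrFun₂ hsq 0 0
  exact mul_self_eq_one_iff.1 (by simpa using hentry)

end IsSignedPauli

section Kronecker

variable {a b : ℕ}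

open scoped Kronecker

theorem kronAB_eq_submatrix (t : Matrix (Fin a → Fin 2) (Fin a → Fin 2) ℂ)
    (u : Matrix (Fin b → Fin 2) (Fin b → Fin 2) ℂ) :
    kronAB t u = (t ⊗ₖ u).submatrix (splitEquiv a b) (splitEquiv a b) :=
  rfl

theorem kronAB_one_one :
    kronAB (1 : Matrix (Fin a → Fin 2) (Fin a → Fin 2) ℂ)
      (1 : Matrix (Fin b → Fin 2) (Fin b → Fin 2) ℂ) = 1 := by
  rw [kronAB_eq_submatrix, Matrix.one_kronecker_one, Matrix.submatrix_one_equiv]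

theorem kronAB_mul_kronAB (t t' : Matrix (Fin a → Fin 2) (Fin a → Fin 2) ℂ)
    (u u' : Matrix (Fin b → Fin 2) (Fin b → Fin 2) ℂ) :
    kronAB t u * kronAB t' u' = kronAB (t * t') (u * u') := by
  simp only [kronAB_eq_submatrix, Matrix.submatrix_mul_equiv, Matrix.mul_kronecker_mul]

theorem kronAB_right_injective {t : Matrix (Fin a → Fin 2) (Fin a → Fin 2) ℂ} (ht : t ≠ 0) :
    Function.Injective (kronAB (b := b) t) := by
  intro u u' h
  obtain ⟨i, j, hij⟩ : ∃ i j, t i j ≠ 0 := by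
    by_contra! h0
    exact ht (Matrix.ext h0)
  ext k l
  have hentry := congrFun₂ h ((splitEquiv a b).symm (i, k)) ((splitEquiv a b).symm (j, l))
  simp only [kronAB, Matrix.of_apply, Equiv.apply_symm_apply] at hentry
  exact mul_left_cancel₀ hij hentry

theorem commute_of_commute_kronAB {t t' : Matrix (Fin a → Fin 2) (Fin a → Fin 2) ℂ}
    {u u' : Matrix (Fin b → Fin 2) (Fin b → Fin 2) ℂ} (ht : Commute t t') (h0 : t * t' ≠ 0)
    (h : Commute (kronAB t u) (kronAB t' u')) : Commute u u' := by
  refine kronAB_right_injective h0 ?_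
  have h' := h.eq
  rwa [kronAB_mul_kronAB, kronAB_mul_kronAB, ← ht.eq] at h'

end Kronecker

/-- the set of signed `b`-qubit Pauli strings `u` for which `t ⊗ u ∈ S`
for some `t ∈ T` is an abelian subgroup of the invertible `2^b × 2^b` matrices. -/
theorem bParts_form_abelian_subgroup {a b : ℕ} (ha : 1 ≤ a) (hb : 1 ≤ b)
    (T : Subgroup (Matrix.GeneralLinearGroup (Fin a → Fin 2) ℂ))
    (S : Subgroup (Matrix.GeneralLinearGroup (Fin (a + b) → Fin 2) ℂ))
    (hT : ∀ t ∈ T, IsSignedPauli (t : Matrix (Fin a → Fin 2) (Fin a → Fin 2) ℂ))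
    (hTab : ∀ t ∈ T, ∀ t' ∈ T, t * t' = t' * t)
    (hS : ∀ s ∈ S, IsSignedPauli (s : Matrix (Fin (a + b) → Fin 2) (Fin (a + b) → Fin 2) ℂ))
    (hSab : ∀ s ∈ S, ∀ s' ∈ S, s * s' = s' * s) :
    ∃ U : Subgroup (Matrix.GeneralLinearGroup (Fin b → Fin 2) ℂ),
      (∀ u ∈ U, ∀ u' ∈ U, u * u' = u' * u) ∧
      ((fun g : Matrix.GeneralLinearGroup (Fin b → Fin 2) ℂ =>
          (g : Matrix (Fin b → Fin 2) (Fin b → Fin 2) ℂ)) '' (U : Set _)) =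
        {u : Matrix (Fin b → Fin 2) (Fin b → Fin 2) ℂ | IsSignedPauli u ∧
          ∃ t ∈ T, ∃ s ∈ S,
            (s : Matrix (Fin (a + b) → Fin 2) (Fin (a + b) → Fin 2) ℂ) =
              kronAB (t : Matrix (Fin a → Fin 2) (Fin a → Fin 2) ℂ) u} := by
  have hcomm : ∀ {u u' : Matrix (Fin b → Fin 2) (Fin b → Fin 2) ℂ},
      (∃ t ∈ T, ∃ s ∈ S, s.val = kronAB t.val u) →
      (∃ t ∈ T, ∃ s ∈ S, s.val = kronAB t.val u') → Commute u u' := by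
    rintro u u' ⟨t, ht, s, hs, hsu⟩ ⟨t', ht', s', hs', hsu'⟩
    refine commute_of_commute_kronAB (congrArg Units.val (hTab t ht t' ht'))
      (t * t').ne_zero ?_
    rw [← hsu, ← hsu']
    exact congrArg Units.val (hSab s hs s' hs')
  let U : Subgroup (Matrix.GeneralLinearGroup (Fin b → Fin 2) ℂ) :=
    { carrier := {g | IsSignedPauli g.val ∧ ∃ t ∈ T, ∃ s ∈ S, s.val = kronAB t.val g.val}
      one_mem' := ⟨IsSignedPauli.one, 1, T.one_mem, 1, S.one_mem, kronAB_one_one.symm⟩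
      mul_mem' := by
        rintro g g' ⟨hg, hgS⟩ ⟨hg', hgS'⟩
        refine ⟨hg.mul_of_commute hg' (hcomm hgS hgS'), ?_⟩
        obtain ⟨t, ht, s, hs, hsg⟩ := hgS
        obtain ⟨t', ht', s', hs', hsg'⟩ := hgS'
        refine ⟨t * t', T.mul_mem ht ht', s * s', S.mul_mem hs hs', ?_⟩
        simp only [Units.val_mul, hsg, hsg', kronAB_mul_kronAB]
      inv_mem' := by
        rintro g ⟨hg, hgS⟩
        have hinv : g⁻¹ = g := inv_eq_of_mul_eq_one_right (Units.ext hg.mul_self)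
        rw [hinv]
        exact ⟨hg, hgS⟩ }
  refine ⟨U, fun u hu u' hu' => Units.ext (hcomm hu.2 hu'.2), Set.ext fun u => ⟨?_, ?_⟩⟩
  · rintro ⟨g, hg, rfl⟩
    exact hg
  · intro hu
    exact ⟨⟨u, u, hu.1.mul_self, hu.1.mul_self⟩, hu, rfl⟩
end

section
/- Let G_x be a finite simple graph on a finite vertex set V_x with a distinguished vertex a_x, and let G_y be a finite simple graph on a finite vertex set V_y with a distinguished vertex a_y. Let |Ḡ_y⟩ ∈ ℂ^{Fin 2 × (V_y → Fin 2)} be the augmented graph state with component at (c, z) equal to (if c = z(a_y) then (−1)^{q_{G_y}(z)} else 0). Let w ∈ ℂ^{((V_x ∖ {a_x}) → Fin 2) × (V_y → Fin 2)} be the Bell contraction of |G_x⟩ with |Ḡ_y⟩ on the qubit a_x and the augmentation qubit, i.e., w(x', z) = Σ_{b ∈ Fin 2} (component of |G_x⟩ at the extension of x' by x'(a_x) := b) · (component of |Ḡ_y⟩ at (b, z)). Then w(x', z) = Σ_{b ∈ Fin 2} (if z(a_y) = b then 1 else 0) · (−1)^{b · Σ_{c ∈ N_{a_x}} x'(c)}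 · (−1)^{q_{G_x − a_x}(x')} · (−1)^{q_{G_y}(z)}; equivalently, w = |G_x/a_x⟩ ⊗ |0⟩_{a_y}|G_y⟩-component + σ_Z^{N_{a_x}}-twisted term, i.e., w = Σ_{b∈{0,1}} (σ_Z^{N_{a_x}})^b |G_x − a_x⟩ ⊗ (the restriction of |G_y⟩ to z(a_y) = b). -/
open scoped Classical in
/-- The quadratic form `q_G(x) = Σ_{{a,b} ∈ E(G)} x(a)·x(b)` of a graph `G`, computed in `ℤ`. -/
noncomputable def graphQ {V : Type*} [Fintype V] (G : SimpleGraph V) (x : V → Fin 2) : ℤ :=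
  ∑ e ∈ G.edgeFinset,
    Sym2.lift ⟨fun a b => ((x a : ℕ) : ℤ) * ((x b : ℕ) : ℤ),
      fun a b => mul_comm _ _⟩ e

/-- The (unnormalized) graph state `|G⟩`, with component `(-1)^{q_G(x)}` at `x`. -/
noncomputable def graphState {V : Type*} [Fintype V] (G : SimpleGraph V) (x : V → Fin 2) : ℂ :=
  (-1 : ℂ) ^ (graphQ G x)

/-- The augmented graph state `|Ḡ⟩` of `|G⟩` at the vertex `a`: its component at `(c, z)` is
`(-1)^{q_G(z)}` if `c = z(a)` and `0` otherwise. -/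
noncomputable def augGraphState {V : Type*} [Fintype V] (G : SimpleGraph V) (a : V)
    (c : Fin 2) (z : V → Fin 2) : ℂ :=
  if c = z a then graphState G z else 0

open scoped Classical in
theorem SimpleGraph.filter_mem_edgeFinset_eq_image {V : Type*} [Fintype V] (G : SimpleGraph V)
    (a : V) :
    G.edgeFinset.filter (fun e => a ∈ e) =
      (Finset.univ.filter (fun c : ↥({v : V | v ≠ a}) => G.Adj a c.val)).image
        (fun c => s(a, c.val)) := by
  ext e
  simp only [Finset.mem_filter, Finset.mem_image, Finset.mem_univ, true_and,
    SimpleGraph.mem_edgeFinset]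
  constructor
  · rintro ⟨he, c, rfl⟩
    exact ⟨⟨c, (G.ne_of_adj he).symm⟩, he, rfl⟩
  · rintro ⟨c, hc, rfl⟩
    exact ⟨hc, Sym2.mem_mk_left _ _⟩

open scoped Classical in
theorem SimpleGraph.filter_notMem_edgeFinset_eq_image {V : Type*} [Fintype V] (G : SimpleGraph V)
    (a : V) :
    G.edgeFinset.filter (fun e => a ∉ e) =
      (G.induce {v : V | v ≠ a}).edgeFinset.image (Sym2.map Subtype.val) := by
  ext e
  simp only [Finset.mem_filter, Finset.mem_image, SimpleGraph.mem_edgeFinset]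
  constructor
  · induction e with | _ u v
    rintro ⟨he, ha⟩
    rw [Sym2.mem_iff, not_or] at ha
    exact ⟨s(⟨u, Ne.symm ha.1⟩, ⟨v, Ne.symm ha.2⟩), he, rfl⟩
  · rintro ⟨f, hf, rfl⟩
    induction f with | _ u v
    refine ⟨hf, ?_⟩
    rw [Sym2.map_mk, Sym2.mem_iff, not_or]
    exact ⟨Ne.symm u.2, Ne.symm v.2⟩

open scoped Classical in
/-- Splitting off the edges at `a` from the quadratic form of a graph. -/
theorem graphQ_extend {V : Type*} [Fintype V] (G : SimpleGraph V) (a : V) (b : Fin 2)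
    (x' : ↥({v : V | v ≠ a}) → Fin 2) :
    graphQ G (fun v => if h : v = a then b else x' ⟨v, h⟩) =
      ((b : ℕ) : ℤ) *
          ∑ c ∈ Finset.univ.filter (fun c : ↥({v : V | v ≠ a}) => G.Adj a c.val),
            ((x' c : ℕ) : ℤ) +
        graphQ (G.induce {v : V | v ≠ a}) x' := by
  have hext (c : ↥({v : V | v ≠ a})) :
      (if h : c.val = a then b else x' ⟨c.val, h⟩) = x' c := dif_neg c.2
  unfold graphQ
  rw [← Finset.sum_filter_add_sum_filter_not _ (fun e => a ∈ e),
    G.filter_mem_edgeFinset_eq_image, G.filter_notMem_edgeFinset_eq_image,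
    Finset.sum_image, Finset.sum_image, Finset.mul_sum]
  · congr 1
    · refine Finset.sum_congr rfl fun c _ => ?_
      rw [Sym2.lift_mk]
      dsimp only
      rw [hext, dif_pos rfl]
    · refine Finset.sum_congr rfl fun e _ => ?_
      induction e with | _ u v
      rw [Sym2.map_mk, Sym2.lift_mk, Sym2.lift_mk]
      dsimp only
      rw [hext, hext]
  · exact (Sym2.map.injective Subtype.val_injective).injOn
  · intro c _ d _ h
    exact Subtype.ext (Sym2.congr_right.mp h)

open scoped Classical in
/-- Lemma 1 of the paper: Bell-contracting the graph state `|G_x⟩` on the qubit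
`a_x` with the augmentation qubit of the augmented graph state `|Ḡ_y⟩` yields
`Σ_b [z(a_y) = b] · (-1)^{b·Σ_{c ∈ N_{a_x}} x'(c)} · (-1)^{q_{G_x − a_x}(x')} · (-1)^{q_{G_y}(z)}`. -/
theorem bell_contraction_graphState_augGraphState {Vx Vy : Type*} [Fintype Vx] [Fintype Vy]
    (Gx : SimpleGraph Vx) (Gy : SimpleGraph Vy) (ax : Vx) (ay : Vy)
    (x' : ↥({v : Vx | v ≠ ax}) → Fin 2) (z : Vy → Fin 2) :
    (∑ b : Fin 2,
        graphState Gx (fun v => if h : v = ax then b else x' ⟨v, h⟩) *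
          augGraphState Gy ay b z) =
      ∑ b : Fin 2,
        (if z ay = b then (1 : ℂ) else 0) *
          (-1 : ℂ) ^ (((b : ℕ) : ℤ) *
              ∑ c ∈ Finset.univ.filter (fun c : ↥({v : Vx | v ≠ ax}) => Gx.Adj ax c.val),
                ((x' c : ℕ) : ℤ)) *
          (-1 : ℂ) ^ (graphQ (Gx.induce {v : Vx | v ≠ ax}) x') *
          (-1 : ℂ) ^ (graphQ Gy z) := by
  refine Finset.sum_congr rfl fun b _ => ?_
  unfold augGraphState graphState
  rw [graphQ_extend, zpow_add₀ (by norm_num)]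
  by_cases hb : b = z ay
  · rw [if_pos hb, if_pos hb.symm, one_mul]
  · rw [if_neg hb, if_neg (Ne.symm hb)]
    simp
end

section
/- Let G be a finite simple graph on a finite vertex set V, and let V = A ⊔ B be a partition of V into two nonempty sets. Let M be the complex matrix indexed by (A → Fin 2) × (B → Fin 2) with M(x, y) = (−1)^{q_G(x ⊔ y)}, the coefficient matrix of the graph state |G⟩ across the bipartition {A, B}. Let Γ_{AB} be the matrix over ZMod 2 indexed by A × B with Γ_{AB}(a, b) = 1 if {a, b} ∈ E(G) and 0 otherwise. Then the rank of M over ℂ equals 2^{r}, where r is the rank of Γ_{AB} over ZMod 2. (Hence the entanglement rank r_{AB} = log₂ rank(ρ^G_A) of the graph state equals rank_{𝔽₂}(Γ_{AB}).) -/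
/-- Summing a symmetric function over ordered adjacent pairs counts every edge twice. -/
theorem SimpleGraph.sum_adj_eq_two_mul_sum_edgeFinset {V R : Type*} [Fintype V] [CommSemiring R]
    (G : SimpleGraph V) [DecidableRel G.Adj] (f : Sym2 V → R) :
    ∑ u, ∑ v, (if G.Adj u v then f s(u, v) else 0) = 2 * ∑ e ∈ G.edgeFinset, f e := by
  classical
  calc ∑ u, ∑ v, (if G.Adj u v then f s(u, v) else 0)
      = ∑ d : G.Dart, f d.edge := by
        rw [← Fintype.sum_prod_type', ← Finset.sum_filter]
        symm
        refine Finset.sum_bij' (fun d _ => (d.fst, d.snd))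
          (fun p hp => ⟨p, (Finset.mem_filter.1 hp).2⟩) ?_ ?_ ?_ ?_ ?_ <;> simp [Dart.edge]
    _ = ∑ e ∈ G.edgeFinset, ∑ d : G.Dart with d.edge = e, f e :=
        (Finset.sum_fiberwise_of_maps_to'
          (fun d _ => G.mem_edgeFinset.2 d.edge_mem) f).symm
    _ = 2 * ∑ e ∈ G.edgeFinset, f e := by
        rw [Finset.mul_sum]
        refine Finset.sum_congr rfl fun e he => ?_
        rw [Finset.sum_const, G.dart_edge_fiber_card e (G.mem_edgeFinset.1 he), nsmul_eq_mul,
          Nat.cast_ofNat]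

open scoped Classical in
theorem two_mul_graphQ {V : Type*} [Fintype V] (G : SimpleGraph V) (z : V → Fin 2) :
    2 * graphQ G z =
      ∑ u, ∑ v, (if G.Adj u v then ((z u : ℕ) : ℤ) * ((z v : ℕ) : ℤ) else 0) := by
  rw [graphQ, ← SimpleGraph.sum_adj_eq_two_mul_sum_edgeFinset]
  rfl

open scoped Classical in
/-- If `z = x + y` where at each vertex the values do not overflow, then `q_G(z)` splits as
`q_G(x) + q_G(y)` plus the polar form. -/
theorem graphQ_of_add {V : Type*} [Fintype V] (G : SimpleGraph V) (x y z : V → Fin 2)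
    (h : ∀ v, (z v : ℕ) = (x v : ℕ) + (y v : ℕ)) :
    graphQ G z = graphQ G x + graphQ G y +
      ∑ u, ∑ v, (if G.Adj u v then ((x u : ℕ) : ℤ) * ((y v : ℕ) : ℤ) else 0) := by
  have hsymm : ∑ u, ∑ v, (if G.Adj u v then ((y u : ℕ) : ℤ) * ((x v : ℕ) : ℤ) else 0) =
      ∑ u, ∑ v, (if G.Adj u v then ((x u : ℕ) : ℤ) * ((y v : ℕ) : ℤ) else 0) := by
    rw [Finset.sum_comm]
    simp only [G.adj_comm, mul_comm]
  have hsum : 2 * graphQ G z = 2 * graphQ G x + 2 * graphQ G y +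
      ∑ u, ∑ v, (if G.Adj u v then ((x u : ℕ) : ℤ) * ((y v : ℕ) : ℤ) else 0) +
      ∑ u, ∑ v, (if G.Adj u v then ((y u : ℕ) : ℤ) * ((x v : ℕ) : ℤ) else 0) := by
    simp only [two_mul_graphQ, ← Finset.sum_add_distrib]
    refine Finset.sum_congr rfl fun u _ => Finset.sum_congr rfl fun v _ => ?_
    split_ifs
    · rw [h, h]
      push_cast
      ring
    · simp
  rw [hsymm] at hsum
  linarith

/-- The nontrivial additive character of `ZMod 2`. -/
noncomputable def signChar : AddChar (ZMod 2) ℂ :=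
  AddChar.zmodChar 2 (ζ := -1) (by norm_num)

theorem signChar_intCast (k : ℤ) : signChar (k : ZMod 2) = (-1 : ℂ) ^ k := by
  rcases Int.even_or_odd k with hk | hk
  · rw [hk.neg_one_zpow, (ZMod.intCast_eq_zero_iff_even).2 hk, AddChar.map_zero_eq_one]
  · rw [hk.neg_one_zpow, (ZMod.intCast_eq_one_iff_odd).2 hk, signChar, AddChar.zmodChar_apply,
      ZMod.val_one, pow_one]

theorem signChar_eq_one_iff {t : ZMod 2} : signChar t = 1 ↔ t = 0 := by
  refine ⟨fun h => ?_, fun h => by rw [h, AddChar.map_zero_eq_one]⟩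
  fin_cases t
  · rfl
  · exfalso
    change signChar (1 : ZMod 2) = 1 at h
    rw [signChar, AddChar.zmodChar_apply, ZMod.val_one, pow_one] at h
    norm_num at h

/-- The character `x ↦ (-1)^{x ⬝ w}` of `𝔽₂^m`. -/
noncomputable def dotChar {m : Type*} [Fintype m] (w : m → ZMod 2) : AddChar (m → ZMod 2) ℂ where
  toFun x := signChar (x ⬝ᵥ w)
  map_zero_eq_one' := by simp
  map_add_eq_mul' x y := by rw [add_dotProduct, AddChar.map_add_eq_mul]

theorem dotChar_injective {m : Type*} [Fintype m] :
    Function.Injective (dotChar : (m → ZMod 2) → AddChar (m → ZMod 2) ℂ) := by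
  classical
  intro w w' h
  ext1 i
  have hi : signChar (w i) = signChar (w' i) := by
    simpa [dotChar] using DFunLike.congr_fun h (Pi.single i 1)
  rw [← sub_eq_zero, ← signChar_eq_one_iff, sub_eq_add_neg, AddChar.map_add_eq_mul, hi,
    ← AddChar.map_add_eq_mul, add_neg_cancel, AddChar.map_zero_eq_one]

/-- The complex rank of the sign matrix of a bilinear form over `𝔽₂` is `2` to the rank of the
form. -/
theorem rank_signChar_bilin {m n : Type*} [Fintype m] [Fintype n] [DecidableEq n]
    (Γ : Matrix m n (ZMod 2)) :
    (Matrix.of fun (x : m → ZMod 2) (y : n → ZMod 2) => signChar (x ⬝ᵥ Γ.mulVec y)).rank =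
      2 ^ Γ.rank := by
  classical
  let S := LinearMap.range Γ.mulVecLin
  let v : S → (m → ZMod 2) → ℂ := fun w => dotChar (w : m → ZMod 2)
  have hv : LinearIndependent ℂ v :=
    (AddChar.linearIndependent (m → ZMod 2) ℂ).comp (fun w : S => dotChar (w : m → ZMod 2))
      (dotChar_injective.comp Subtype.val_injective)
  have hcol : Set.range (Matrix.of fun (x : m → ZMod 2) (y : n → ZMod 2) =>
      signChar (x ⬝ᵥ Γ.mulVec y)).col = Set.range v := by
    ext c
    constructor
    · rintro ⟨y, rfl⟩
      exact ⟨⟨Γ.mulVec y, y, rfl⟩, rfl⟩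
    · rintro ⟨⟨_, y, rfl⟩, rfl⟩
      exact ⟨y, rfl⟩
  rw [Matrix.rank_eq_finrank_span_cols, hcol, finrank_span_eq_card hv,
    Module.card_eq_pow_finrank (K := ZMod 2), ZMod.card, Matrix.rank]

/-- Rescaling rows and columns by nonzero scalars does not change the rank. -/
theorem Matrix.rank_of_mul_mul {m n K : Type*} [Fintype m] [Fintype n] [Field K]
    (N : Matrix m n K) (f : m → K) (g : n → K) (hf : ∀ i, f i ≠ 0) (hg : ∀ j, g j ≠ 0) :
    (Matrix.of fun i j => f i * N i j * g j).rank = N.rank := by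
  classical
  have h : (Matrix.of fun i j => f i * N i j * g j) =
      Matrix.diagonal f * N * Matrix.diagonal g := by
    ext i j
    simp
  rw [h, Matrix.rank_mul_eq_left_of_isUnit_det, Matrix.rank_mul_eq_right_of_isUnit_det]
  · simpa [Matrix.det_diagonal, Finset.prod_eq_zero_iff] using hf
  · simpa [Matrix.det_diagonal, Finset.prod_eq_zero_iff] using hg

theorem graphState_ne_zero {V : Type*} [Fintype V] (G : SimpleGraph V) (x : V → Fin 2) :
    graphState G x ≠ 0 :=
  zpow_ne_zero _ (neg_ne_zero.2 one_ne_zero)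

open scoped Classical in
/-- The coefficients of a graph state across a bipartition are, up to local phases, the signs of
the bilinear form of the off-diagonal block. -/
theorem graphState_eq_mul_signChar_mul {V : Type*} [Fintype V] (G : SimpleGraph V) (A : Finset V)
    (x : ↥A → ZMod 2) (y : ↥Aᶜ → ZMod 2) :
    graphState G (fun v => if h : v ∈ A then x ⟨v, h⟩ else y ⟨v, Finset.mem_compl.mpr h⟩) =
      graphState G (fun v => if h : v ∈ A then x ⟨v, h⟩ else (0 : Fin 2)) *
        signChar (x ⬝ᵥ (Matrix.of fun (p : ↥A) (q : ↥Aᶜ) =>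
          if G.Adj p.val q.val then (1 : ZMod 2) else 0).mulVec y) *
        graphState G (fun v => if h : v ∈ A then (0 : Fin 2) else
          y ⟨v, Finset.mem_compl.mpr h⟩) := by
  set x' : V → Fin 2 := fun v => if h : v ∈ A then x ⟨v, h⟩ else (0 : Fin 2) with hx'
  set y' : V → Fin 2 := fun v => if h : v ∈ A then (0 : Fin 2) else
    y ⟨v, Finset.mem_compl.mpr h⟩ with hy'
  have hx : ∀ p : ↥A, ((x' p : ℕ) : ZMod 2) = x p := fun p => by
    have h : x' p = x p := dif_pos p.2
    rw [h]
    exact ZMod.natCast_zmod_val (x p)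
  have hy : ∀ q : ↥Aᶜ, ((y' q : ℕ) : ZMod 2) = y q := fun q => by
    have h : y' q = y q := dif_neg (Finset.mem_compl.1 q.2)
    rw [h]
    exact ZMod.natCast_zmod_val (y q)
  have hx0 : ∀ u ∈ Aᶜ, x' u = 0 := fun u hu => by simp [hx', Finset.mem_compl.1 hu]
  have hy0 : ∀ u ∈ A, y' u = 0 := fun u hu => by simp [hy', hu]
  have hcross : ((∑ u, ∑ v, (if G.Adj u v then ((x' u : ℕ) : ℤ) * ((y' v : ℕ) : ℤ) else 0) : ℤ) :
      ZMod 2) = x ⬝ᵥ (Matrix.of fun (p : ↥A) (q : ↥Aᶜ) =>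
          if G.Adj p.val q.val then (1 : ZMod 2) else 0).mulVec y := by
    push_cast
    rw [← Finset.sum_add_sum_compl A, Finset.sum_eq_zero (s := Aᶜ)
      (fun u hu => by simp [hx0 u hu]), add_zero, ← Finset.sum_coe_sort A]
    refine Finset.sum_congr rfl fun p _ => ?_
    rw [← Finset.sum_add_sum_compl A, Finset.sum_eq_zero (s := A)
      (fun u hu => by simp [hy0 u hu]), zero_add, ← Finset.sum_coe_sort Aᶜ, Matrix.mulVec,
      dotProduct, Finset.mul_sum]
    refine Finset.sum_congr rfl fun q _ => ?_
    rw [hx, hy, Matrix.of_apply]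
    split_ifs <;> simp
  rw [← hcross, signChar_intCast, graphState, graphState, graphState,
    graphQ_of_add G x' y' _ fun v => ?_, zpow_add₀ (by norm_num), zpow_add₀ (by norm_num)]
  · ring
  · by_cases h : v ∈ A <;> simp [hx', hy', h]

open scoped Classical in
/-- Eq. (15) of the paper: the Schmidt rank of a graph state across a
bipartition `{A, B}` equals `2^r` where `r` is the `𝔽₂`-rank of the off-diagonal block
`Γ_{AB}` of the adjacency matrix. -/
theorem rank_graphState_coeff_matrix {V : Type*} [Fintype V] (G : SimpleGraph V)
    (A : Finset V) (hA : A.Nonempty) (hB : Aᶜ.Nonempty) :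
    (Matrix.of fun (x : ↥A → Fin 2) (y : ↥Aᶜ → Fin 2) =>
        graphState G (fun v =>
          if h : v ∈ A then x ⟨v, h⟩ else y ⟨v, Finset.mem_compl.mpr h⟩)).rank =
      2 ^ (Matrix.of fun (p : ↥A) (q : ↥Aᶜ) =>
        if G.Adj p.val q.val then (1 : ZMod 2) else 0).rank := by
  refine Eq.trans ?_ (rank_signChar_bilin _)
  rw [← Matrix.rank_of_mul_mul _
    (fun x : ↥A → ZMod 2 => graphState G (fun v => if h : v ∈ A then x ⟨v, h⟩ else (0 : Fin 2)))
    (fun y : ↥Aᶜ → ZMod 2 => graphState G (fun v => if h : v ∈ A then (0 : Fin 2) else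
      y ⟨v, Finset.mem_compl.mpr h⟩))
    (fun _ => graphState_ne_zero _ _) (fun _ => graphState_ne_zero _ _)]
  exact congrArg Matrix.rank (Matrix.ext fun x y => graphState_eq_mul_signChar_mul G A x y)
end

section
/- Let H be the 6 × 18 matrix over ZMod 2 whose rows are: (1,0,0,1,0,1,0,0,1 | 0,1,1,0,0,0,1,1,0), (1,0,1,1,0,0,1,0,0 | 0,0,0,0,1,1,0,1,1), (0,1,0,0,1,0,0,1,0 | 0,0,1,1,0,0,0,0,1), (0,1,0,0,1,0,0,1,0 | 1,0,0,0,0,1,1,0,0), (0,1,1,1,0,0,0,0,0 | 1,1,1,0,1,1,0,0,0), (1,1,1,1,1,1,0,0,0 | 1,0,0,1,0,0,0,0,0). For every nonzero vector (v_X | v_Z) ∈ (ZMod 2)^9 × (ZMod 2)^9 whose Pauli weight |{ i | v_X(i) = 1 ∨ v_Z(i) = 1 }| is at most 2, there exists a row (w_X | w_Z) of H such that the symplectic product Σ_{i=1}^{9} (v_X(i)·w_Z(i) + v_Z(i)·w_X(i)) equals 1 in ZMod 2. (Hence every nonidentity 9-qubit Pauli operator of weight at most 2 anticommutes with at least one of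 the six stabilizer generators, so the [[9,3,3]] code can correct any single-qubit error.) -/
/-- The `6 × 18` binary matrix `H` of Eq. (46) of the paper: the symplectic representation
`(v_X | v_Z)` of the six 9-qubit stabilizer generators
`XZZXIXZZX, XIXXZZXZZ, IXZZXIIXZ, ZXIIXZZXI, ZYYXZZIII, YXXYXXIII`. -/
def Hmat : Matrix (Fin 6) (Fin 18) (ZMod 2) :=
  !![1,0,0,1,0,1,0,0,1, 0,1,1,0,0,0,1,1,0;
     1,0,1,1,0,0,1,0,0, 0,0,0,0,1,1,0,1,1;
     0,1,0,0,1,0,0,1,0, 0,0,1,1,0,0,0,0,1;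
     0,1,0,0,1,0,0,1,0, 1,0,0,0,0,1,1,0,0;
     0,1,1,1,0,0,0,0,0, 1,1,1,0,1,1,0,0,0;
     1,1,1,1,1,1,0,0,0, 1,0,0,1,0,0,0,0,0]

/-- Every nonidentity Pauli operator supported on two distinct qubits `i` and `j` anticommutes with
some row of `Hmat`. -/
theorem Hmat_detects_pair : ∀ i j : Fin 9, i ≠ j → ∀ a b c d : ZMod 2,
    ¬(a = 0 ∧ b = 0 ∧ c = 0 ∧ d = 0) → ∃ r : Fin 6,
      a * Hmat r ⟨(i : ℕ) + 9, by have := i.isLt; omega⟩ +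
          b * Hmat r ⟨(i : ℕ), by have := i.isLt; omega⟩ +
        (c * Hmat r ⟨(j : ℕ) + 9, by have := j.isLt; omega⟩ +
          d * Hmat r ⟨(j : ℕ), by have := j.isLt; omega⟩) = 1 := by
  decide +kernel

/-- every nonzero symplectic vector `(v_X | v_Z)` of Pauli weight at most `2`
has symplectic product `1` with at least one row of `H`: every nonidentity 9-qubit Pauli
operator of weight at most two anticommutes with some stabilizer generator, so the
`[[9,3,3]]` code corrects any single-qubit error. -/
theorem Hmat_detects_weight_two_errors (vX vZ : Fin 9 → ZMod 2)
    (hnz : ¬(vX = 0 ∧ vZ = 0))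
    (hwt : (Finset.univ.filter (fun i : Fin 9 => vX i = 1 ∨ vZ i = 1)).card ≤ 2) :
    ∃ r : Fin 6,
      (∑ i : Fin 9,
          (vX i * Hmat r ⟨(i : ℕ) + 9, by have := i.isLt; omega⟩ +
            vZ i * Hmat r ⟨(i : ℕ), by have := i.isLt; omega⟩)) = 1 := by
  obtain ⟨t, hst, ht⟩ := Finset.exists_superset_card_eq hwt (by simp)
  obtain ⟨i, j, hij, rfl⟩ := Finset.card_eq_two.mp ht
  have eq_zero_of_ne_one : ∀ x : ZMod 2, x ≠ 1 → x = 0 := by decide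
  have hout : ∀ k ∉ ({i, j} : Finset (Fin 9)), vX k = 0 ∧ vZ k = 0 := by
    intro k hk
    have hk' : ¬(vX k = 1 ∨ vZ k = 1) := fun h => hk (hst (by simpa using h))
    rw [not_or] at hk'
    exact ⟨eq_zero_of_ne_one _ hk'.1, eq_zero_of_ne_one _ hk'.2⟩
  obtain ⟨r, hr⟩ := Hmat_detects_pair i j hij (vX i) (vZ i) (vX j) (vZ j) (by
    rintro ⟨hXi, hZi, hXj, hZj⟩
    have hzero : ∀ k, vX k = 0 ∧ vZ k = 0 := by
      intro k
      by_cases hk : k ∈ ({i, j} : Finset (Fin 9))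
      · rcases Finset.mem_insert.mp hk with rfl | hk
        · exact ⟨hXi, hZi⟩
        · rw [Finset.mem_singleton.mp hk]
          exact ⟨hXj, hZj⟩
      · exact hout k hk
    exact hnz ⟨funext fun k => (hzero k).1, funext fun k => (hzero k).2⟩)
  refine ⟨r, ?_⟩
  rw [← Finset.sum_subset (Finset.subset_univ {i, j}), Finset.sum_pair hij, hr]
  intro k _ hk
  simp [hout k hk]
end
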